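/- Let A and B be isoclinic skew left braces. Then there exists a skew left brace W with sub-skew braces Ā and B̄ such that A ≅ Ā, B ≅ B̄ (brace isomorphisms), and Ā·Ann(W) = Ā∘Ann(W) = W = B̄∘Ann(W) = B̄·Ann(W), where Ā·Ann(W) = {x·u : x ∈ Ā, u ∈ Ann(W)} and Ā∘Ann(W) = {x∘u : x ∈ Ā, u ∈ Ann(W)}. -/

import Mathlib

set_option linter.unusedVariables false

universe u v

/-- A skew left brace: a carrier with two group structures `(A,·)` (written `dmul`) and
`(A,∘)` (written `cmul`) sharing the same identity `ident`, satisfying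
`a ∘ (b · c) = (a ∘ b) · a⁻¹ · (a ∘ c)`. -/
class SkewBrace (A : Type u) where
  dmul : A → A → A
  ident : A
  dinv : A → A
  cmul : A → A → A
  cinv : A → A
  dmul_assoc : ∀ a b c : A, dmul (dmul a b) c = dmul a (dmul b c)
  ident_dmul : ∀ a : A, dmul ident a = a
  dmul_ident : ∀ a : A, dmul a ident = a
  dinv_dmul : ∀ a : A, dmul (dinv a) a = ident
  dmul_dinv : ∀ a : A, dmul a (dinv a) = ident
  cmul_assoc : ∀ a b c : A, cmul (cmul a b) c = cmul a (cmul b c)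
  ident_cmul : ∀ a : A, cmul ident a = a
  cmul_ident : ∀ a : A, cmul a ident = a
  cinv_cmul : ∀ a : A, cmul (cinv a) a = ident
  cmul_cinv : ∀ a : A, cmul a (cinv a) = ident
  compat : ∀ a b c : A, cmul a (dmul b c) = dmul (dmul (cmul a b) (dinv a)) (cmul a c)

namespace SkewBrace

variable {A : Type u} [SkewBrace A]

/-- The lambda map `λ_a(b) = a⁻¹ · (a ∘ b)`. -/
def lam (a b : A) : A := dmul (dinv a) (cmul a b)

/-- The star operation `a * b = λ_a(b) · b⁻¹`. -/
def bstar (a b : A) : A := dmul (lam a b) (dinv b)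

/-- The dot commutator `[a,b]· = a · b · a⁻¹ · b⁻¹`. -/
def dcomm (a b : A) : A := dmul (dmul (dmul a b) (dinv a)) (dinv b)

/-- The circle commutator `[a,b]∘ = a ∘ b ∘ ā ∘ b̄`. -/
def ccomm (a b : A) : A := cmul (cmul (cmul a b) (cinv a)) (cinv b)

/-- Membership in the subgroup of `(A,·)` generated by a subset. -/
inductive dclosure (S : Set A) : A → Prop
  | mem {x : A} : x ∈ S → dclosure S x
  | one : dclosure S ident
  | mul {x y : A} : dclosure S x → dclosure S y → dclosure S (dmul x y)
  | inv {x : A} : dclosure S x → dclosure S (dinv x)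

/-- The subgroup of `(A,·)` generated by a subset, as a set. -/
def dcl (S : Set A) : Set A := {x | dclosure S x}

/-- Membership in the subgroup of `(A,∘)` generated by a subset. -/
inductive cclosure (S : Set A) : A → Prop
  | mem {x : A} : x ∈ S → cclosure S x
  | one : cclosure S ident
  | mul {x y : A} : cclosure S x → cclosure S y → cclosure S (cmul x y)
  | inv {x : A} : cclosure S x → cclosure S (cinv x)

/-- The subgroup of `(A,∘)` generated by a subset, as a set. -/
def ccl (S : Set A) : Set A := {x | cclosure S x}

/-- The set `{x * y : x ∈ I, y ∈ J}` (star values). -/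
def starSet (I J : Set A) : Set A := {x | ∃ a ∈ I, ∃ b ∈ J, x = bstar a b}

/-- The set of dot commutators `[a,b]·` with `a ∈ I`, `b ∈ J`. -/
def dcommSet (I J : Set A) : Set A := {x | ∃ a ∈ I, ∃ b ∈ J, x = dcomm a b}

/-- The set of circle commutators `[a,b]∘` with `a ∈ I`, `b ∈ J`. -/
def ccommSet (I J : Set A) : Set A := {x | ∃ a ∈ I, ∃ b ∈ J, x = ccomm a b}

/-- The lower central series `Γ_n(A)` of the skew brace `A` (`Gamma A n = Γ_n(A)` for `n ≥ 1`):
`Γ₁(A) = A` and `Γ_n(A) = ⟨A * Γ_{n-1}(A), Γ_{n-1}(A) * A, [A,Γ_{n-1}(A)]·⟩·`. -/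
def Gamma (A : Type u) [SkewBrace A] : ℕ → Set A
  | 0 => Set.univ
  | 1 => Set.univ
  | (n+2) =>
      dcl (starSet Set.univ (Gamma A (n+1)) ∪ starSet (Gamma A (n+1)) Set.univ ∪
        dcommSet Set.univ (Gamma A (n+1)))

/-- The lower central series `γ_n(A,∘)` of the group `(A,∘)`
(`gammaCirc A n = γ_n(A,∘)` for `n ≥ 1`). -/
def gammaCirc (A : Type u) [SkewBrace A] : ℕ → Set A
  | 0 => Set.univ
  | 1 => Set.univ
  | (n+2) => ccl (ccommSet (gammaCirc A (n+1)) Set.univ)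

/-- The series `Γ̄_n(A)`: `Γ̄₁(A) = A`, `Γ̄_n(A) = ⟨A * Γ̄_{n-1}(A), [A, Γ̄_{n-1}(A)]·⟩·`. -/
def GammaBar (A : Type u) [SkewBrace A] : ℕ → Set A
  | 0 => Set.univ
  | 1 => Set.univ
  | (n+2) =>
      dcl (starSet Set.univ (GammaBar A (n+1)) ∪ dcommSet Set.univ (GammaBar A (n+1)))

/-- The annihilator series: `AnnS A n = Ann_n(A)`, with `Ann_0(A) = 1` and
`Ann_n(A) = {a | a*b, b*a, [a,b]· ∈ Ann_{n-1}(A) for all b}`. -/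
def AnnS (A : Type u) [SkewBrace A] : ℕ → Set A
  | 0 => {ident}
  | (n+1) => {a | ∀ b : A, bstar a b ∈ AnnS A n ∧ bstar b a ∈ AnnS A n ∧ dcomm a b ∈ AnnS A n}

/-- The alphabet `X = {γ·, γ̄·, *, *̄}` of brace commutator symbols. -/
inductive BWord : Type
  | g | gbar | s | sbar

/-- Evaluation of a single symbol of `X`. -/
def evalX : BWord → A → A → A
  | BWord.g => dcomm
  | BWord.gbar => fun a b => dcomm b a
  | BWord.s => bstar
  | BWord.sbar => fun a b => bstar b a

/-- `evalW e a n` is the value `m(a₀ a₁ ⋯ a_n)` of the degree-`n` brace commutator word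
`m = (e 0)(e 1)⋯(e (n-1))` on the arguments `a 0, …, a n`:
`m(a₀ ⋯ a_n) = (e 0)(a₀, (e 1)(a₁, …, (e (n-1))(a_{n-1}, a_n)⋯))`. -/
def evalW : (ℕ → BWord) → (ℕ → A) → ℕ → A
  | _, a, 0 => a 0
  | e, a, (n+1) => evalX (e 0) (a 0) (evalW (fun i => e (i+1)) (fun i => a (i+1)) n)

/-- `Asub A t = A_{(t)}`, the subgroup of `(A,·)` generated by all values of brace commutator
words of degree `≥ t`. -/
def Asub (A : Type u) [SkewBrace A] (t : ℕ) : Set A :=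
  dcl {x | ∃ s : ℕ, t ≤ s ∧ ∃ (e : ℕ → BWord) (a : ℕ → A), x = evalW e a s}

/-- `Sset A r = S_r(A)`, the set of all values of brace commutator words of degree exactly `r`
(`S_0(A) = A`). -/
def Sset (A : Type u) [SkewBrace A] (r : ℕ) : Set A :=
  {x | ∃ (e : ℕ → BWord) (a : ℕ → A), x = evalW e a r}

/-- `cosetRel I a b` says that `b` lies in the coset `I · a`. -/
def cosetRel (I : Set A) (a b : A) : Prop := ∃ c ∈ I, b = dmul c a

/-- The class `I_n`: the maps `φ_m : (A/Ann_n(A))^{n+1} → A_{(n)}`,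
`(Ann_n(A)a₁, …, Ann_n(A)a_{n+1}) ↦ m(a₁⋯a_{n+1})`, are well defined for every word `m` of
degree `n`. -/
def InClass (A : Type u) [SkewBrace A] (n : ℕ) : Prop :=
  ∀ (e : ℕ → BWord) (a b : ℕ → A),
    (∀ i : ℕ, i ≤ n → cosetRel (AnnS A n) (a i) (b i)) →
    evalW e b n = evalW e a n

/-- A skew left brace `(A,·,∘)` is symmetric if `(A,∘,·)` is also a skew left brace, i.e.
`a · (b ∘ c) = (a · b) ∘ ā ∘ (a · c)`. -/
def IsSymmetric (A : Type u) [SkewBrace A] : Prop :=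
  ∀ a b c : A, dmul a (cmul b c) = cmul (cmul (dmul a b) (cinv a)) (dmul a c)

/-- A sub-skew brace: a subset which is a subgroup of both `(A,·)` and `(A,∘)`. -/
structure IsSubBrace (A : Type u) [SkewBrace A] (S : Set A) : Prop where
  ident_mem : ident ∈ S
  dmul_mem : ∀ {x y : A}, x ∈ S → y ∈ S → dmul x y ∈ S
  dinv_mem : ∀ {x : A}, x ∈ S → dinv x ∈ S
  cmul_mem : ∀ {x y : A}, x ∈ S → y ∈ S → cmul x y ∈ S
  cinv_mem : ∀ {x : A}, x ∈ S → cinv x ∈ S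

/-- An ideal of a skew brace: a subgroup of `(A,·)`, normal in `(A,·)` and `(A,∘)`,
and invariant under all `λ_a`. -/
structure IsIdeal (A : Type u) [SkewBrace A] (I : Set A) : Prop where
  ident_mem : ident ∈ I
  dmul_mem : ∀ {x y : A}, x ∈ I → y ∈ I → dmul x y ∈ I
  dinv_mem : ∀ {x : A}, x ∈ I → dinv x ∈ I
  dconj_mem : ∀ (a : A) {x : A}, x ∈ I → dmul (dmul a x) (dinv a) ∈ I
  cconj_mem : ∀ (a : A) {x : A}, x ∈ I → cmul (cmul a x) (cinv a) ∈ I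
  lam_mem : ∀ (a : A) {x : A}, x ∈ I → lam a x ∈ I

/-- A homomorphism of skew braces. -/
structure IsBraceHom {A : Type u} {B : Type v} [SkewBrace A] [SkewBrace B] (f : A → B) : Prop where
  map_dmul : ∀ x y : A, f (dmul x y) = dmul (f x) (f y)
  map_cmul : ∀ x y : A, f (cmul x y) = cmul (f x) (f y)

/-- The data of an isoclinism of skew braces along ideals `I` of `A` and `J` of `B`:
`ξ` induces a brace isomorphism `A/I → B/J` and `θ` restricts to a brace isomorphism
`Γ₂(A) → Γ₂(B)` compatible with the commutator and star maps. -/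
structure IsoclinismData (A : Type u) (B : Type v) [SkewBrace A] [SkewBrace B]
    (I : Set A) (J : Set B) (ξ θ : A → B) : Prop where
  xi_resp : ∀ a a' : A, cosetRel I a a' ↔ cosetRel J (ξ a) (ξ a')
  xi_surj : ∀ b : B, ∃ a : A, cosetRel J b (ξ a)
  xi_dmul : ∀ a a' : A, cosetRel J (dmul (ξ a) (ξ a')) (ξ (dmul a a'))
  xi_cmul : ∀ a a' : A, cosetRel J (cmul (ξ a) (ξ a')) (ξ (cmul a a'))
  theta_maps : ∀ x ∈ Gamma A 2, θ x ∈ Gamma B 2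
  theta_inj : ∀ x ∈ Gamma A 2, ∀ y ∈ Gamma A 2, θ x = θ y → x = y
  theta_surj : ∀ y ∈ Gamma B 2, ∃ x ∈ Gamma A 2, θ x = y
  theta_dmul : ∀ x ∈ Gamma A 2, ∀ y ∈ Gamma A 2, θ (dmul x y) = dmul (θ x) (θ y)
  theta_cmul : ∀ x ∈ Gamma A 2, ∀ y ∈ Gamma A 2, θ (cmul x y) = cmul (θ x) (θ y)
  compat_dcomm : ∀ a₁ a₂ : A, ∀ b₁ b₂ : B, cosetRel J b₁ (ξ a₁) → cosetRel J b₂ (ξ a₂) →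
    θ (dcomm a₁ a₂) = dcomm b₁ b₂
  compat_star : ∀ a₁ a₂ : A, ∀ b₁ b₂ : B, cosetRel J b₁ (ξ a₁) → cosetRel J b₂ (ξ a₂) →
    θ (bstar a₁ a₂) = bstar b₁ b₂

/-- Isoclinism (1-isoclinism) of skew left braces. -/
def Isoclinic (A : Type u) (B : Type v) [SkewBrace A] [SkewBrace B] : Prop :=
  ∃ ξ θ : A → B, IsoclinismData A B (AnnS A 1) (AnnS B 1) ξ θ

/-- The data of an `n`-isoclinism of skew braces: `ξ` induces a brace isomorphism
`A/Ann_n(A) → B/Ann_n(B)` and `θ` restricts to a brace isomorphism `A_{(n)} → B_{(n)}`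
commuting with all brace commutator word maps of degree `n`. -/
structure IsoclinismDataN (A : Type u) (B : Type v) [SkewBrace A] [SkewBrace B]
    (n : ℕ) (ξ θ : A → B) : Prop where
  xi_resp : ∀ a a' : A, cosetRel (AnnS A n) a a' ↔ cosetRel (AnnS B n) (ξ a) (ξ a')
  xi_surj : ∀ b : B, ∃ a : A, cosetRel (AnnS B n) b (ξ a)
  xi_dmul : ∀ a a' : A, cosetRel (AnnS B n) (dmul (ξ a) (ξ a')) (ξ (dmul a a'))
  xi_cmul : ∀ a a' : A, cosetRel (AnnS B n) (cmul (ξ a) (ξ a')) (ξ (cmul a a'))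
  theta_maps : ∀ x ∈ Asub A n, θ x ∈ Asub B n
  theta_inj : ∀ x ∈ Asub A n, ∀ y ∈ Asub A n, θ x = θ y → x = y
  theta_surj : ∀ y ∈ Asub B n, ∃ x ∈ Asub A n, θ x = y
  theta_dmul : ∀ x ∈ Asub A n, ∀ y ∈ Asub A n, θ (dmul x y) = dmul (θ x) (θ y)
  theta_cmul : ∀ x ∈ Asub A n, ∀ y ∈ Asub A n, θ (cmul x y) = cmul (θ x) (θ y)
  compat : ∀ (e : ℕ → BWord) (a : ℕ → A) (b : ℕ → B),
    (∀ i : ℕ, i ≤ n → cosetRel (AnnS B n) (b i) (ξ (a i))) →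
    θ (evalW e a n) = evalW e b n

/-- `n`-isoclinism of skew left braces. -/
def IsoclinicN (A : Type u) (B : Type v) [SkewBrace A] [SkewBrace B] (n : ℕ) : Prop :=
  ∃ ξ θ : A → B, IsoclinismDataN A B n ξ θ

/-- The product set `S · T = {s · t : s ∈ S, t ∈ T}` in `(A,·)`. -/
def setDProd (S T : Set A) : Set A := {x | ∃ s ∈ S, ∃ t ∈ T, x = dmul s t}

/-- The product set `S ∘ T = {s ∘ t : s ∈ S, t ∈ T}` in `(A,∘)`. -/
def setCProd (S T : Set A) : Set A := {x | ∃ s ∈ S, ∃ t ∈ T, x = cmul s t}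

/-- The skew brace structure on a sub-skew brace. -/
def subBrace (S : Set A) (h : IsSubBrace A S) : SkewBrace S where
  dmul x y := ⟨dmul x.1 y.1, h.dmul_mem x.2 y.2⟩
  ident := ⟨ident, h.ident_mem⟩
  dinv x := ⟨dinv x.1, h.dinv_mem x.2⟩
  cmul x y := ⟨cmul x.1 y.1, h.cmul_mem x.2 y.2⟩
  cinv x := ⟨cinv x.1, h.cinv_mem x.2⟩
  dmul_assoc a b c := Subtype.ext (dmul_assoc a.1 b.1 c.1)
  ident_dmul a := Subtype.ext (ident_dmul a.1)
  dmul_ident a := Subtype.ext (dmul_ident a.1)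
  dinv_dmul a := Subtype.ext (dinv_dmul a.1)
  dmul_dinv a := Subtype.ext (dmul_dinv a.1)
  cmul_assoc a b c := Subtype.ext (cmul_assoc a.1 b.1 c.1)
  ident_cmul a := Subtype.ext (ident_cmul a.1)
  cmul_ident a := Subtype.ext (cmul_ident a.1)
  cinv_cmul a := Subtype.ext (cinv_cmul a.1)
  cmul_cinv a := Subtype.ext (cmul_cinv a.1)
  compat a b c := Subtype.ext (compat a.1 b.1 c.1)

/-- The direct product of two skew braces, with componentwise operations. -/
instance prodBrace (A : Type u) (B : Type v) [SkewBrace A] [SkewBrace B] :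
    SkewBrace (A × B) where
  dmul p q := (dmul p.1 q.1, dmul p.2 q.2)
  ident := (ident, ident)
  dinv p := (dinv p.1, dinv p.2)
  cmul p q := (cmul p.1 q.1, cmul p.2 q.2)
  cinv p := (cinv p.1, cinv p.2)
  dmul_assoc a b c := Prod.ext_iff.mpr ⟨dmul_assoc _ _ _, dmul_assoc _ _ _⟩
  ident_dmul a := Prod.ext_iff.mpr ⟨ident_dmul _, ident_dmul _⟩
  dmul_ident a := Prod.ext_iff.mpr ⟨dmul_ident _, dmul_ident _⟩
  dinv_dmul a := Prod.ext_iff.mpr ⟨dinv_dmul _, dinv_dmul _⟩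
  dmul_dinv a := Prod.ext_iff.mpr ⟨dmul_dinv _, dmul_dinv _⟩
  cmul_assoc a b c := Prod.ext_iff.mpr ⟨cmul_assoc _ _ _, cmul_assoc _ _ _⟩
  ident_cmul a := Prod.ext_iff.mpr ⟨ident_cmul _, ident_cmul _⟩
  cmul_ident a := Prod.ext_iff.mpr ⟨cmul_ident _, cmul_ident _⟩
  cinv_cmul a := Prod.ext_iff.mpr ⟨cinv_cmul _, cinv_cmul _⟩
  cmul_cinv a := Prod.ext_iff.mpr ⟨cmul_cinv _, cmul_cinv _⟩
  compat a b c := Prod.ext_iff.mpr ⟨compat _ _ _, compat _ _ _⟩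

end SkewBrace

open SkewBrace

/-- Auxiliary predicate for `isoclinic_embedding`: `W` contains sub-skew braces `Ā ≅ A` and
`B̄ ≅ B` with `Ā·Ann(W) = Ā∘Ann(W) = W = B̄∘Ann(W) = B̄·Ann(W)`. -/
def Stmt13Concl (A B : Type u) [SkewBrace A] [SkewBrace B]
    (W : Type u) [SkewBrace W] : Prop :=
  ∃ (SA SB : Set W) (f : A → W) (g : B → W),
    IsSubBrace W SA ∧ IsSubBrace W SB ∧
    IsBraceHom f ∧ Function.Injective f ∧ Set.range f = SA ∧
    IsBraceHom g ∧ Function.Injective g ∧ Set.range g = SB ∧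
    setDProd SA (AnnS W 1) = Set.univ ∧ setCProd SA (AnnS W 1) = Set.univ ∧
    setCProd SB (AnnS W 1) = Set.univ ∧ setDProd SB (AnnS W 1) = Set.univ

namespace SkewBrace

section Basic

variable {X : Type u} [SkewBrace X]

lemma dinv_dmul_cancel_left (a b : X) : dmul (dinv a) (dmul a b) = b := by
  rw [← dmul_assoc, dinv_dmul, ident_dmul]

lemma dmul_dinv_cancel_left (a b : X) : dmul a (dmul (dinv a) b) = b := by
  rw [← dmul_assoc, dmul_dinv, ident_dmul]

lemma cinv_cmul_cancel_left (a b : X) : cmul (cinv a) (cmul a b) = b := by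
  rw [← cmul_assoc, cinv_cmul, ident_cmul]

lemma dmul_left_cancel {a b c : X} (h : dmul a b = dmul a c) : b = c := by
  rw [← dinv_dmul_cancel_left a b, h, dinv_dmul_cancel_left]

lemma dmul_right_cancel {a b c : X} (h : dmul b a = dmul c a) : b = c := by
  have := congrArg (fun x => dmul x (dinv a)) h
  simpa only [dmul_assoc, dmul_dinv, dmul_ident] using this

lemma cmul_left_cancel {a b c : X} (h : cmul a b = cmul a c) : b = c := by
  rw [← cinv_cmul_cancel_left a b, h, cinv_cmul_cancel_left]

lemma cmul_right_cancel {a b c : X} (h : cmul b a = cmul c a) : b = c := by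
  have := congrArg (fun x => cmul x (cinv a)) h
  simpa only [cmul_assoc, cmul_cinv, cmul_ident] using this

lemma dmul_dinv_eq_ident_iff {a b : X} : dmul a (dinv b) = ident ↔ a = b := by
  refine ⟨fun h => dmul_right_cancel (a := dinv b) (by rw [h, dmul_dinv]), ?_⟩
  rintro rfl
  exact dmul_dinv _

lemma eq_dinv_of_dmul_eq_ident {a b : X} (h : dmul a b = ident) : b = dinv a :=
  dmul_left_cancel (a := a) (by rw [h, dmul_dinv])

lemma dinv_ident : dinv (ident : X) = ident :=
  (eq_dinv_of_dmul_eq_ident (ident_dmul _)).symm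

lemma eq_ident_of_dmul_self {a : X} (h : dmul a a = a) : a = ident :=
  dmul_left_cancel (a := a) (by rw [h, dmul_ident])

lemma bstar_eq_ident_iff {a b : X} : bstar a b = ident ↔ cmul a b = dmul a b := by
  rw [bstar, dmul_dinv_eq_ident_iff, lam]
  constructor
  · intro h
    rw [← dmul_dinv_cancel_left a (cmul a b), h]
  · intro h
    rw [h, dinv_dmul_cancel_left]

lemma dcomm_eq_ident_iff {a b : X} : dcomm a b = ident ↔ dmul a b = dmul b a := by
  rw [dcomm, dmul_dinv_eq_ident_iff]
  constructor
  · intro h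
    rw [← h, dmul_assoc (dmul a b), dinv_dmul, dmul_ident, h]
  · intro h
    rw [h, dmul_assoc, dmul_dinv, dmul_ident]

lemma cmul_eq_dmul_bstar_dmul (a b : X) : cmul a b = dmul a (dmul (bstar a b) b) := by
  rw [bstar, lam, dmul_assoc, dinv_dmul, dmul_ident, dmul_dinv_cancel_left]

lemma mem_annS_one_iff {z : X} :
    z ∈ AnnS X 1 ↔
      ∀ b, cmul z b = dmul z b ∧ cmul b z = dmul b z ∧ dmul z b = dmul b z := by
  change (∀ b, bstar z b = ident ∧ bstar b z = ident ∧ dcomm z b = ident) ↔ _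
  simp only [bstar_eq_ident_iff, dcomm_eq_ident_iff]

lemma ident_mem_annS_one : (ident : X) ∈ AnnS X 1 := by
  simp [mem_annS_one_iff, ident_cmul, ident_dmul, cmul_ident, dmul_ident]

lemma dmul_mem_annS_one {z w : X} (hz : z ∈ AnnS X 1) (hw : w ∈ AnnS X 1) :
    dmul z w ∈ AnnS X 1 := by
  rw [mem_annS_one_iff] at *
  intro b
  refine ⟨?_, ?_, ?_⟩
  · rw [← (hz w).1, cmul_assoc, (hw b).1, (hz _).1, (hz w).1, dmul_assoc]
  · rw [← (hz w).1, ← cmul_assoc, (hw _).2.1, (hz b).2.1, (hz w).1, dmul_assoc]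
  · rw [dmul_assoc, (hw b).2.2, ← dmul_assoc, (hz b).2.2, dmul_assoc]

lemma dinv_mem_annS_one {z : X} (hz : z ∈ AnnS X 1) : dinv z ∈ AnnS X 1 := by
  rw [mem_annS_one_iff] at *
  have hc : cmul z (dinv z) = ident := by rw [(hz _).1, dmul_dinv]
  have hc' : cmul (dinv z) z = ident := by rw [(hz _).2.1, dinv_dmul]
  intro b
  refine ⟨?_, ?_, ?_⟩
  · apply cmul_left_cancel (a := z)
    rw [← cmul_assoc, hc, ident_cmul, (hz _).1, dmul_dinv_cancel_left]
  · apply cmul_right_cancel (a := z)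
    rw [cmul_assoc, hc', cmul_ident, (hz _).2.1, dmul_assoc, dinv_dmul, dmul_ident]
  · apply dmul_left_cancel (a := z)
    rw [dmul_dinv_cancel_left, ← dmul_assoc, (hz b).2.2, dmul_assoc, dmul_dinv, dmul_ident]

lemma bstar_mem_Gamma_two (a b : X) : bstar a b ∈ Gamma X 2 :=
  dclosure.mem (Or.inl (Or.inl ⟨a, trivial, b, trivial, rfl⟩))

lemma dcomm_mem_Gamma_two (a b : X) : dcomm a b ∈ Gamma X 2 :=
  dclosure.mem (Or.inr ⟨a, trivial, b, trivial, rfl⟩)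

lemma setCProd_annS_one_eq_univ {S : Set X} (h : setDProd S (AnnS X 1) = Set.univ) :
    setCProd S (AnnS X 1) = Set.univ := by
  rw [Set.eq_univ_iff_forall] at *
  intro x
  obtain ⟨s, hs, t, ht, rfl⟩ := h x
  exact ⟨s, hs, t, ht, ((mem_annS_one_iff.1 ht s).2.1).symm⟩

/-- A subgroup of `(X,·)` contained in the annihilator. -/
structure IsAnnSubgroup (K : Set X) : Prop where
  le_ann : ∀ {x}, x ∈ K → x ∈ AnnS X 1
  ident_mem : ident ∈ K
  dmul_mem : ∀ {x y}, x ∈ K → y ∈ K → dmul x y ∈ K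
  dinv_mem : ∀ {x}, x ∈ K → dinv x ∈ K

lemma isAnnSubgroup_annS_one : IsAnnSubgroup (AnnS X 1) :=
  ⟨id, ident_mem_annS_one, dmul_mem_annS_one, dinv_mem_annS_one⟩

namespace IsAnnSubgroup

variable {K : Set X} (hK : IsAnnSubgroup K)

include hK

lemma refl (a : X) : cosetRel K a a := ⟨ident, hK.ident_mem, (ident_dmul a).symm⟩

lemma symm {a b : X} : cosetRel K a b → cosetRel K b a := by
  rintro ⟨c, hc, rfl⟩
  exact ⟨dinv c, hK.dinv_mem hc, (dinv_dmul_cancel_left c a).symm⟩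

lemma trans {a b c : X} : cosetRel K a b → cosetRel K b c → cosetRel K a c := by
  rintro ⟨z, hz, rfl⟩ ⟨w, hw, rfl⟩
  exact ⟨dmul w z, hK.dmul_mem hw hz, (dmul_assoc w z a).symm⟩

lemma dmul_congr {a a' b b' : X} :
    cosetRel K a a' → cosetRel K b b' → cosetRel K (dmul a b) (dmul a' b') := by
  rintro ⟨z, hz, rfl⟩ ⟨w, hw, rfl⟩
  refine ⟨dmul z w, hK.dmul_mem hz hw, ?_⟩
  rw [dmul_assoc, dmul_assoc, ← dmul_assoc a w b,
    ← (mem_annS_one_iff.1 (hK.le_ann hw) a).2.2, dmul_assoc]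

lemma cmul_congr {a a' b b' : X} :
    cosetRel K a a' → cosetRel K b b' → cosetRel K (cmul a b) (cmul a' b') := by
  rintro ⟨z, hz, rfl⟩ ⟨w, hw, rfl⟩
  have hz' := mem_annS_one_iff.1 (hK.le_ann hz)
  have hw' := mem_annS_one_iff.1 (hK.le_ann hw)
  refine ⟨dmul z w, hK.dmul_mem hz hw, ?_⟩
  rw [← (hz' a).1, ← (hw' b).1, cmul_assoc, ← cmul_assoc a w b, (hw' a).2.1, ← (hw' a).2.2,
    ← (hw' a).1, cmul_assoc w, (hz' _).1, (hw' _).1, dmul_assoc]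

lemma dinv_rel {a b : X} (h : cosetRel K (dmul a b) ident) : cosetRel K b (dinv a) := by
  simpa only [dinv_dmul_cancel_left, dmul_ident] using hK.dmul_congr (hK.refl (dinv a)) h

lemma cinv_rel {a b : X} (h : cosetRel K (cmul a b) ident) : cosetRel K b (cinv a) := by
  simpa only [cinv_cmul_cancel_left, cmul_ident] using hK.cmul_congr (hK.refl (cinv a)) h

lemma dinv_congr {a b : X} (h : cosetRel K a b) : cosetRel K (dinv a) (dinv b) := by
  apply hK.dinv_rel
  simpa only [dmul_dinv] using hK.dmul_congr (hK.symm h) (hK.refl (dinv a))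

lemma cinv_congr {a b : X} (h : cosetRel K a b) : cosetRel K (cinv a) (cinv b) := by
  apply hK.cinv_rel
  simpa only [cmul_cinv] using hK.cmul_congr (hK.symm h) (hK.refl (cinv a))

end IsAnnSubgroup

/-- The coset relation of a subgroup of the annihilator. -/
def IsAnnSubgroup.setoid {K : Set X} (hK : IsAnnSubgroup K) : Setoid X :=
  ⟨cosetRel K, hK.refl, hK.symm, hK.trans⟩

/-- The quotient of a skew brace by a subgroup of its annihilator. -/
@[reducible]
def IsAnnSubgroup.quotientBrace {K : Set X} (hK : IsAnnSubgroup K) :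
    SkewBrace (Quotient hK.setoid) where
  dmul := Quotient.map₂ dmul fun _ _ h _ _ h' => hK.dmul_congr h h'
  ident := Quotient.mk _ ident
  dinv := Quotient.map dinv fun _ _ h => hK.dinv_congr h
  cmul := Quotient.map₂ cmul fun _ _ h _ _ h' => hK.cmul_congr h h'
  cinv := Quotient.map cinv fun _ _ h => hK.cinv_congr h
  dmul_assoc := by
    rintro ⟨a⟩ ⟨b⟩ ⟨c⟩
    exact congrArg (Quotient.mk _) (dmul_assoc a b c)
  ident_dmul := by
    rintro ⟨a⟩
    exact congrArg (Quotient.mk _) (ident_dmul a)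
  dmul_ident := by
    rintro ⟨a⟩
    exact congrArg (Quotient.mk _) (dmul_ident a)
  dinv_dmul := by
    rintro ⟨a⟩
    exact congrArg (Quotient.mk _) (dinv_dmul a)
  dmul_dinv := by
    rintro ⟨a⟩
    exact congrArg (Quotient.mk _) (dmul_dinv a)
  cmul_assoc := by
    rintro ⟨a⟩ ⟨b⟩ ⟨c⟩
    exact congrArg (Quotient.mk _) (cmul_assoc a b c)
  ident_cmul := by
    rintro ⟨a⟩
    exact congrArg (Quotient.mk _) (ident_cmul a)
  cmul_ident := by
    rintro ⟨a⟩
    exact congrArg (Quotient.mk _) (cmul_ident a)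
  cinv_cmul := by
    rintro ⟨a⟩
    exact congrArg (Quotient.mk _) (cinv_cmul a)
  cmul_cinv := by
    rintro ⟨a⟩
    exact congrArg (Quotient.mk _) (cmul_cinv a)
  compat := by
    rintro ⟨a⟩ ⟨b⟩ ⟨c⟩
    exact congrArg (Quotient.mk _) (compat a b c)

/-- Quotients by subgroups of the annihilator, as an existence statement. -/
lemma IsAnnSubgroup.exists_quotient {K : Set X} (hK : IsAnnSubgroup K) :
    ∃ (W : Type u) (_ : SkewBrace W) (q : X → W), IsBraceHom q ∧ Function.Surjective q ∧
      ∀ x y, q x = q y ↔ cosetRel K x y := by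
  let := hK.quotientBrace
  exact ⟨_, hK.quotientBrace, Quotient.mk _, ⟨fun _ _ => rfl, fun _ _ => rfl⟩,
    Quotient.mk_surjective, fun _ _ => Quotient.eq⟩

/-- The dot group of a skew brace. -/
@[reducible]
def dotGroup (X : Type u) [SkewBrace X] : Group X where
  mul := dmul
  one := ident
  inv := dinv
  mul_assoc := dmul_assoc
  one_mul := ident_dmul
  mul_one := dmul_ident
  inv_mul_cancel := dinv_dmul

/-- A commutative group, viewed as a trivial skew brace. -/
@[reducible]
def trivialBrace (T : Type u) [Group T] (comm : ∀ a b : T, a * b = b * a) : SkewBrace T where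
  dmul a b := a * b
  ident := 1
  dinv a := a⁻¹
  cmul a b := a * b
  cinv a := a⁻¹
  dmul_assoc := mul_assoc
  ident_dmul := one_mul
  dmul_ident := mul_one
  dinv_dmul := inv_mul_cancel
  dmul_dinv := mul_inv_cancel
  cmul_assoc := mul_assoc
  ident_cmul := one_mul
  cmul_ident := mul_one
  cinv_cmul := inv_mul_cancel
  cmul_cinv := mul_inv_cancel
  compat a b c := by group

/-- The abelianization `X / Γ₂(X)` of a skew brace. -/
lemma exists_abelianization (X : Type u) [SkewBrace X] :
    ∃ (T : Type u) (_ : SkewBrace T) (τ : X → T), IsBraceHom τ ∧ (∀ t : T, t ∈ AnnS T 1) ∧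
      ∀ x, τ x = ident → x ∈ Gamma X 2 := by
  let : Group X := dotGroup X
  let N : Subgroup X :=
    { carrier := Gamma X 2
      mul_mem' := dclosure.mul
      one_mem' := dclosure.one
      inv_mem' := dclosure.inv }
  have hcomm : ∀ a b : X, a * b * a⁻¹ * b⁻¹ ∈ N := dcomm_mem_Gamma_two
  have hN : N.Normal := ⟨fun n hn g => by
    have := N.mul_mem (hcomm g n) hn
    simpa using this⟩
  have comm : ∀ a b : X ⧸ N, a * b = b * a := by
    rintro ⟨a⟩ ⟨b⟩
    refine QuotientGroup.eq.2 ?_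
    have := hcomm b⁻¹ a⁻¹
    simpa [mul_assoc] using this
  let := trivialBrace _ comm
  refine ⟨X ⧸ N, trivialBrace _ comm, QuotientGroup.mk, ⟨fun _ _ => rfl, ?_⟩, ?_, ?_⟩
  · intro x y
    have hs : (QuotientGroup.mk (bstar x y) : X ⧸ N) = 1 :=
      (QuotientGroup.eq_one_iff _).2 (bstar_mem_Gamma_two x y)
    rw [cmul_eq_dmul_bstar_dmul]
    change (QuotientGroup.mk x * (QuotientGroup.mk (bstar x y) * QuotientGroup.mk y) : X ⧸ N) = _
    rw [hs, one_mul]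
    rfl
  · intro t
    rw [mem_annS_one_iff]
    exact fun b => ⟨rfl, rfl, comm t b⟩
  · intro x hx
    exact (QuotientGroup.eq_one_iff x).1 hx

end Basic

section Hom

variable {X : Type u} {Y : Type v} [SkewBrace X] [SkewBrace Y] {f : X → Y}

lemma IsBraceHom.map_ident (hf : IsBraceHom f) : f ident = ident :=
  eq_ident_of_dmul_self (by rw [← hf.map_dmul, ident_dmul])

lemma IsBraceHom.map_dinv (hf : IsBraceHom f) (x : X) : f (dinv x) = dinv (f x) :=
  eq_dinv_of_dmul_eq_ident (by rw [← hf.map_dmul, dmul_dinv, hf.map_ident])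

lemma IsBraceHom.map_cinv (hf : IsBraceHom f) (x : X) : f (cinv x) = cinv (f x) :=
  cmul_left_cancel (a := f x)
    (by rw [← hf.map_cmul, cmul_cinv, hf.map_ident, cmul_cinv])

lemma IsBraceHom.isSubBrace_range (hf : IsBraceHom f) : IsSubBrace Y (Set.range f) where
  ident_mem := ⟨_, hf.map_ident⟩
  dmul_mem := by
    rintro _ _ ⟨x, rfl⟩ ⟨y, rfl⟩
    exact ⟨_, hf.map_dmul x y⟩
  dinv_mem := by
    rintro _ ⟨x, rfl⟩
    exact ⟨_, hf.map_dinv x⟩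
  cmul_mem := by
    rintro _ _ ⟨x, rfl⟩ ⟨y, rfl⟩
    exact ⟨_, hf.map_cmul x y⟩
  cinv_mem := by
    rintro _ ⟨x, rfl⟩
    exact ⟨_, hf.map_cinv x⟩

lemma IsBraceHom.map_mem_annS_one (hf : IsBraceHom f) (hs : Function.Surjective f) {z : X}
    (hz : z ∈ AnnS X 1) : f z ∈ AnnS Y 1 := by
  rw [mem_annS_one_iff] at *
  intro b
  obtain ⟨x, rfl⟩ := hs b
  simp only [← hf.map_dmul, ← hf.map_cmul, hz x, and_self]

lemma prodMk_mem_annS_one {x : X} {y : Y} (hx : x ∈ AnnS X 1) (hy : y ∈ AnnS Y 1) :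
    (x, y) ∈ AnnS (X × Y) 1 := by
  rw [mem_annS_one_iff] at *
  exact fun b => ⟨Prod.ext (hx _).1 (hy _).1, Prod.ext (hx _).2.1 (hy _).2.1,
    Prod.ext (hx _).2.2 (hy _).2.2⟩

end Hom

namespace IsoclinismData

variable {A : Type u} {B : Type u} [SkewBrace A] [SkewBrace B] {ξ θ : A → B}
  (h : IsoclinismData A B (AnnS A 1) (AnnS B 1) ξ θ)

/-- The pullback of `A` and `B` over `A / Ann(A) ≅ B / Ann(B)`. -/
def pullback (ξ : A → B) : Set (A × B) := {p | cosetRel (AnnS B 1) p.2 (ξ p.1)}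

include h

lemma ident_rel : cosetRel (AnnS B 1) ident (ξ ident) := by
  have hJ := isAnnSubgroup_annS_one (X := B)
  have := h.xi_dmul ident ident
  rw [ident_dmul] at this
  simpa only [dinv_dmul_cancel_left, dinv_dmul] using
    hJ.symm (hJ.dmul_congr (hJ.refl (dinv (ξ ident))) this)

lemma isSubBrace_pullback : IsSubBrace (A × B) (pullback ξ) := by
  have hJ := isAnnSubgroup_annS_one (X := B)
  refine ⟨h.ident_rel, ?_, ?_, ?_, ?_⟩
  · exact fun hx hy => hJ.trans (hJ.dmul_congr hx hy) (h.xi_dmul _ _)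
  · rintro ⟨a, b⟩ hx
    refine hJ.symm (hJ.dinv_rel (hJ.trans (hJ.dmul_congr hx (hJ.refl _)) ?_))
    refine hJ.trans (h.xi_dmul _ _) ?_
    change cosetRel _ (ξ (dmul a (dinv a))) ident
    rw [dmul_dinv]
    exact hJ.symm h.ident_rel
  · exact fun hx hy => hJ.trans (hJ.cmul_congr hx hy) (h.xi_cmul _ _)
  · rintro ⟨a, b⟩ hx
    refine hJ.symm (hJ.cinv_rel (hJ.trans (hJ.cmul_congr hx (hJ.refl _)) ?_))
    refine hJ.trans (h.xi_cmul _ _) ?_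
    change cosetRel _ (ξ (cmul a (cinv a))) ident
    rw [cmul_cinv]
    exact hJ.symm h.ident_rel

lemma ann_ident_mem_pullback {z : A} (hz : z ∈ AnnS A 1) : (z, ident) ∈ pullback ξ :=
  isAnnSubgroup_annS_one.trans h.ident_rel
    ((h.xi_resp _ _).1 ⟨z, hz, (dmul_ident z).symm⟩)

lemma ident_ann_mem_pullback {y : B} (hy : y ∈ AnnS B 1) : (ident, y) ∈ pullback ξ :=
  isAnnSubgroup_annS_one.trans
    (isAnnSubgroup_annS_one.symm ⟨y, hy, (dmul_ident y).symm⟩) h.ident_rel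

lemma theta_ident : θ ident = ident :=
  eq_ident_of_dmul_self (by rw [← h.theta_dmul _ dclosure.one _ dclosure.one, ident_dmul])

/-- `Γ₂` of the pullback is contained in the graph of `θ`. -/
lemma theta_fst_of_mem_Gamma_two :
    letI := subBrace (pullback ξ) h.isSubBrace_pullback
    ∀ x : pullback ξ, x ∈ Gamma (pullback ξ) 2 → x.1.1 ∈ Gamma A 2 ∧ θ x.1.1 = x.1.2 := by
  let := subBrace (pullback ξ) h.isSubBrace_pullback
  intro x hx
  induction hx with
  | mem hx =>
    have hstar : ∀ a b : pullback ξ, (bstar a b).1.1 ∈ Gamma A 2 ∧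
        θ (bstar a b).1.1 = (bstar a b).1.2 := fun a b =>
      ⟨bstar_mem_Gamma_two a.1.1 b.1.1, h.compat_star _ _ _ _ a.2 b.2⟩
    rcases hx with (⟨a, -, b, -, rfl⟩ | ⟨a, -, b, -, rfl⟩) | ⟨a, -, b, -, rfl⟩
    · exact hstar a b
    · exact hstar a b
    · exact ⟨dcomm_mem_Gamma_two a.1.1 b.1.1, h.compat_dcomm _ _ _ _ a.2 b.2⟩
  | one => exact ⟨dclosure.one, h.theta_ident⟩
  | mul _ _ hx hy =>
    refine ⟨dclosure.mul hx.1 hy.1, (h.theta_dmul _ hx.1 _ hy.1).trans ?_⟩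
    rw [hx.2, hy.2]
    rfl
  | inv _ hx =>
    refine ⟨dclosure.inv hx.1, (eq_dinv_of_dmul_eq_ident ?_).trans (congrArg dinv hx.2)⟩
    exact (h.theta_dmul _ hx.1 _ (dclosure.inv hx.1)).symm.trans
      ((congrArg θ (dmul_dinv _)).trans h.theta_ident)

end IsoclinismData

end SkewBrace

/-- Let `A` and `B` be isoclinic skew braces. Then there is a skew brace `W` with sub-skew
braces `Ā ≅ A` and `B̄ ≅ B` such that
`Ā·Ann(W) = Ā∘Ann(W) = W = B̄∘Ann(W) = B̄·Ann(W)`. -/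
theorem isoclinic_embedding {A B : Type u} [SkewBrace A] [SkewBrace B] (h : Isoclinic A B) :
    ∃ (W : Type u) (iW : SkewBrace W), @Stmt13Concl A B _ _ W iW := by
  obtain ⟨ξ, θ, h⟩ := h
  let := subBrace _ h.isSubBrace_pullback
  have hJ := isAnnSubgroup_annS_one (X := B)
  obtain ⟨T, _, τ, hτ, hT, hker⟩ :=
    exists_abelianization (IsoclinismData.pullback ξ)
  have hker' x hx := h.theta_fst_of_mem_Gamma_two x (hker x hx)
  let K : Set (A × T) :=
    {p | ∃ hz : p.1 ∈ AnnS A 1, p.2 = τ ⟨(p.1, ident), h.ann_ident_mem_pullback hz⟩}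
  have hK : IsAnnSubgroup K := by
    refine ⟨fun hx => prodMk_mem_annS_one hx.1 (hT _),
      ⟨ident_mem_annS_one, hτ.map_ident.symm⟩, ?_, ?_⟩
    · rintro ⟨z, t⟩ ⟨w, s⟩ ⟨hz, ht⟩ ⟨hw, hs⟩
      refine ⟨dmul_mem_annS_one hz hw,
        (congrArg₂ dmul ht hs).trans ((hτ.map_dmul _ _).symm.trans (congrArg τ ?_))⟩
      exact Subtype.ext (Prod.ext rfl (dmul_ident _))
    · rintro ⟨z, t⟩ ⟨hz, ht⟩
      refine ⟨dinv_mem_annS_one hz,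
        (congrArg dinv ht).trans ((hτ.map_dinv _).symm.trans (congrArg τ ?_))⟩
      exact Subtype.ext (Prod.ext rfl dinv_ident)
  obtain ⟨W, iW, q, hq, hqs, hqK⟩ := hK.exists_quotient
  have hqT (t : T) : q (ident, t) ∈ AnnS W 1 :=
    hq.map_mem_annS_one hqs (prodMk_mem_annS_one ident_mem_annS_one (hT t))
  choose r hr using h.xi_surj
  let g : B → W := fun b => q (r b, τ ⟨(r b, b), hr b⟩)
  have hg (a : A) (b : B) (hab : (a, b) ∈ IsoclinismData.pullback ξ) :
      g b = q (a, τ ⟨(a, b), hab⟩) := by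
    obtain ⟨z, hz, rfl⟩ := (h.xi_resp (r b) a).2 (hJ.trans (hJ.symm (hr b)) hab)
    refine (hqK _ _).2 ⟨(z, τ ⟨(z, ident), h.ann_ident_mem_pullback hz⟩), ⟨hz, rfl⟩, ?_⟩
    refine Prod.ext rfl (Eq.trans (congrArg τ ?_) (hτ.map_dmul _ _))
    exact Subtype.ext (Prod.ext rfl (ident_dmul _).symm)
  let f : A → W := fun a => q (a, ident)
  have hf_hom : IsBraceHom f := by
    refine ⟨fun x y => ?_, fun x y => ?_⟩
    · rw [← hq.map_dmul]
      exact congrArg q (Prod.ext rfl (dmul_ident _).symm)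
    · rw [← hq.map_cmul]
      exact congrArg q (Prod.ext rfl (cmul_ident _).symm)
  have hf_inj : Function.Injective f := by
    intro x y hxy
    obtain ⟨⟨z, t⟩, ⟨hz, ht⟩, e⟩ := (hqK _ _).1 hxy
    obtain ⟨e₁, e₂⟩ := Prod.ext_iff.1 e
    have ht1 : t = ident := (dmul_ident t).symm.trans e₂.symm
    obtain ⟨hz₂, hθ⟩ := hker' _ (ht.symm.trans ht1)
    have hz1 : z = ident :=
      h.theta_inj _ hz₂ _ dclosure.one (hθ.trans h.theta_ident.symm)
    subst hz1
    exact (e₁.trans (ident_dmul x)).symm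
  have hg_hom : IsBraceHom g := by
    refine ⟨fun x y => ?_, fun x y => ?_⟩
    · refine (hg (dmul (r x) (r y)) (dmul x y)
        (h.isSubBrace_pullback.dmul_mem (x := (r x, x)) (y := (r y, y)) (hr x) (hr y))).trans ?_
      rw [← hq.map_dmul]
      exact congrArg q (Prod.ext rfl (hτ.map_dmul ⟨(r x, x), hr x⟩ ⟨(r y, y), hr y⟩))
    · refine (hg (cmul (r x) (r y)) (cmul x y)
        (h.isSubBrace_pullback.cmul_mem (x := (r x, x)) (y := (r y, y)) (hr x) (hr y))).trans ?_
      rw [← hq.map_cmul]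
      exact congrArg q (Prod.ext rfl (hτ.map_cmul ⟨(r x, x), hr x⟩ ⟨(r y, y), hr y⟩))
  have hg_inj : Function.Injective g := by
    intro x y hxy
    obtain ⟨⟨z, t⟩, ⟨hz, ht⟩, e⟩ := (hqK _ _).1 hxy
    obtain ⟨e₁, e₂⟩ := Prod.ext_iff.1 e
    have hx : cosetRel (AnnS B 1) x (ξ (r y)) :=
      hJ.trans (hr x) ((h.xi_resp _ _).1 ⟨z, hz, e₁⟩)
    obtain ⟨w, hw, rfl⟩ := hJ.trans hx (hJ.symm (hr y))
    have e₃ : τ ⟨(r (dmul w x), dmul w x), hr _⟩ = τ ⟨(r (dmul w x), x), hx⟩ := by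
      refine e₂.trans ?_
      change dmul t _ = _
      rw [show t = _ from ht, ← hτ.map_dmul]
      exact congrArg τ (Subtype.ext (Prod.ext e₁.symm (ident_dmul _)))
    have e₄ : τ ⟨(r (dmul w x), dmul w x), hr _⟩ =
        dmul (τ ⟨(ident, w), h.ident_ann_mem_pullback hw⟩) (τ ⟨(r (dmul w x), x), hx⟩) := by
      rw [← hτ.map_dmul]
      exact congrArg τ (Subtype.ext (Prod.ext (ident_dmul _).symm rfl))
    obtain ⟨-, hθ⟩ := hker' ⟨(ident, w), h.ident_ann_mem_pullback hw⟩
      (dmul_right_cancel ((e₄.symm.trans e₃).trans (ident_dmul _).symm))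
    have hw1 : w = ident := hθ.symm.trans h.theta_ident
    rw [hw1, ident_dmul]
  have hf_prod : setDProd (Set.range f) (AnnS W 1) = Set.univ := by
    refine Set.eq_univ_of_forall fun w => ?_
    obtain ⟨⟨a, t⟩, rfl⟩ := hqs w
    refine ⟨_, ⟨a, rfl⟩, _, hqT t, ?_⟩
    rw [← hq.map_dmul]
    exact congrArg q (Prod.ext (dmul_ident _).symm (ident_dmul _).symm)
  have hg_prod : setDProd (Set.range g) (AnnS W 1) = Set.univ := by
    refine Set.eq_univ_of_forall fun w => ?_
    obtain ⟨⟨a, t⟩, rfl⟩ := hqs w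
    have ha : (a, ξ a) ∈ IsoclinismData.pullback ξ := hJ.refl (ξ a)
    refine ⟨_, ⟨ξ a, rfl⟩, _, hqT (dmul (dinv (τ ⟨(a, ξ a), ha⟩)) t), ?_⟩
    rw [hg a (ξ a) ha, ← hq.map_dmul]
    exact congrArg q (Prod.ext (dmul_ident _).symm (dmul_dinv_cancel_left _ _).symm)
  exact ⟨W, iW, Set.range f, Set.range g, f, g, hf_hom.isSubBrace_range,
    hg_hom.isSubBrace_range, hf_hom, hf_inj, rfl, hg_hom, hg_inj, rfl, hf_prod,
    setCProd_annS_one_eq_univ hf_prod, setCProd_annS_one_eq_univ hg_prod, hg_prod⟩
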